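/- Let m ≥ 4 and let p = (p₁,…,p_m) and q = (q₁,…,q_m) be m-tuples of negative vectors in ℍ^{n+1}, pairwise projectively distinct (p_k ∉ p_l·ℍ for k ≠ l, likewise for q), normalized so that ⟨p_k,p_k⟩ = −1 = ⟨q_k,q_k⟩ for all k and ⟨p₁,p_j⟩ and ⟨q₁,q_j⟩ are positive real numbers for all j ≥ 2. Suppose 𝔸(p₁,p_k,p_j) = 𝔸(q₁,q_k,q_j) and d(p_k,p_j) = d(q_k,q_j) for all 1 ≤ k < j ≤ m, and there exists a unit quaternion μ with u(⟨p_j,p_k⟩) = conj(μ)·u(⟨q_j,q_k⟩)·μ for all 2 ≤ k < j ≤ m. Then p and q are PSp(n,1)-congruent. -/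

import Mathlib

noncomputable section

open Quaternion Matrix
open scoped Classical

abbrev ℍq : Type := Quaternion ℝ

/-- Hermitian form matrix of signature (n,1). -/
def qHmat (n : ℕ) : Matrix (Fin (n+1)) (Fin (n+1)) ℍq := fun k j =>
  if (k = 0 ∧ j = Fin.last n) ∨ (k = Fin.last n ∧ j = 0) then 1
  else if k = j ∧ k ≠ 0 ∧ k ≠ Fin.last n then 1 else 0

/-- `herm n z w = ⟨z,w⟩ = w* H z`. -/
def herm (n : ℕ) (z w : Fin (n+1) → ℍq) : ℍq :=
  ∑ k, ∑ j, star (w k) * qHmat n k j * z j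

/-- Two `m`-tuples of vectors are PSp(n,1)-congruent if some `C ∈ Sp(n,1)` carries each
`p k` to `q k` up to a nonzero right quaternionic scalar. -/
def PSpCongruent (n m : ℕ) (p q : Fin m → Fin (n+1) → ℍq) : Prop :=
  ∃ C : Matrix (Fin (n+1)) (Fin (n+1)) ℍq, Cᴴ * qHmat n * C = qHmat n ∧
    ∃ μ : Fin m → ℍq, (∀ k, μ k ≠ 0) ∧ ∀ k, C.mulVec (p k) = fun j => q k j * μ k

/-- An `m`-tuple `p` (first `i` entries null, the rest negative, pairwise projectively
distinct) is semi-normalized if its Gram matrix `g_{kj} = ⟨p_j, p_k⟩` satisfies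
`g_{kk} = 0` for `1 ≤ k ≤ i`, `|g_{23}| = 1`, `g_{1j} = 1` for `2 ≤ j ≤ i`,
`g_{kk} = −1` for `i+1 ≤ k ≤ m`, and `g_{1j}` positive real for `i+1 ≤ j ≤ m`
(1-based indexing). -/
def SemiNormalized (n m i : ℕ) (p : Fin m → Fin (n+1) → ℍq) : Prop :=
  (∀ k, p k ≠ 0) ∧
  (∀ k l : Fin m, k ≠ l → ∀ c : ℍq, p k ≠ fun j => p l j * c) ∧
  (∀ k : Fin m, (k : ℕ) < i → herm n (p k) (p k) = 0) ∧
  (∀ k j : Fin m, (k : ℕ) = 1 → (j : ℕ) = 2 → ‖herm n (p j) (p k)‖ = 1) ∧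
  (∀ k j : Fin m, (k : ℕ) = 0 → 1 ≤ (j : ℕ) → (j : ℕ) < i → herm n (p j) (p k) = 1) ∧
  (∀ k : Fin m, i ≤ (k : ℕ) → herm n (p k) (p k) = -1) ∧
  (∀ k j : Fin m, (k : ℕ) = 0 → i ≤ (j : ℕ) → ∃ r : ℝ, 0 < r ∧ herm n (p j) (p k) = (r : ℍq))

/-- The Korányi–Reimann quaternionic cross ratio. -/
def crossRatio (n : ℕ) (z1 z2 z3 z4 : Fin (n+1) → ℍq) : ℍq :=
  herm n z3 z1 * (herm n z3 z2)⁻¹ * herm n z4 z2 * (herm n z4 z1)⁻¹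

/-- The quaternionic Cartan angular invariant
`𝔸(z₁,z₂,z₃) = arccos(Re(−T)/|T|)` with `T = ⟨z₁,z₂⟩⟨z₂,z₃⟩⟨z₃,z₁⟩`. -/
def angInv (n : ℕ) (z1 z2 z3 : Fin (n+1) → ℍq) : ℝ :=
  Real.arccos ((-(herm n z1 z2 * herm n z2 z3 * herm n z3 z1)).re /
    ‖herm n z1 z2 * herm n z2 z3 * herm n z3 z1‖)

/-- The rotation invariant `u(g) = Im g / |Im g|` (and `0` if `Im g = 0`). -/
def rotInv (g : ℍq) : ℍq := if g.im = 0 then 0 else (‖g.im‖)⁻¹ • g.im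

/-- The distance invariant `d(z,w) = (⟨w,z⟩·⟨z,w⟩)/(⟨w,w⟩·⟨z,z⟩)`. -/
def dInv (n : ℕ) (z w : Fin (n+1) → ℍq) : ℍq :=
  (herm n w z * herm n z w) / (herm n w w * herm n z z)

section HermitianForm

variable {n : ℕ}

theorem qHmat_apply (k j : Fin (n + 1)) :
    qHmat n k j = if j = Equiv.swap 0 (Fin.last n) k then 1 else 0 := by
  unfold qHmat
  by_cases h0 : k = 0
  · subst h0
    by_cases hj : j = Fin.last n
    · simp [hj]
    · simp only [Equiv.swap_apply_left, hj]
      by_cases hj0 : j = 0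
      · subst hj0
        simp [hj]
      · simp [hj0]
  · by_cases hl : k = Fin.last n
    · subst hl
      simp [h0]
    · simp [h0, hl, Equiv.swap_apply_of_ne_of_ne h0 hl, eq_comm]

theorem herm_eq_sum (z w : Fin (n + 1) → ℍq) :
    herm n z w = ∑ k, star (w k) * z (Equiv.swap 0 (Fin.last n) k) := by
  unfold herm
  refine Finset.sum_congr rfl fun k _ => ?_
  rw [Finset.sum_eq_single (Equiv.swap 0 (Fin.last n) k)]
  · simp [qHmat_apply]
  · intro j _ hj
    simp [qHmat_apply, hj]
  · simp

theorem star_herm (z w : Fin (n + 1) → ℍq) : star (herm n z w) = herm n w z := by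
  rw [herm_eq_sum, herm_eq_sum, star_sum,
    ← Equiv.sum_comp (Equiv.swap 0 (Fin.last n))]
  simp

theorem herm_add_left (z z' w : Fin (n + 1) → ℍq) :
    herm n (z + z') w = herm n z w + herm n z' w := by
  simp [herm_eq_sum, mul_add, Finset.sum_add_distrib]

theorem herm_add_right (z w w' : Fin (n + 1) → ℍq) :
    herm n z (w + w') = herm n z w + herm n z w' := by
  simp [herm_eq_sum, add_mul, Finset.sum_add_distrib]

theorem herm_sub_left (z z' w : Fin (n + 1) → ℍq) :
    herm n (z - z') w = herm n z w - herm n z' w := by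
  simp [herm_eq_sum, mul_sub, Finset.sum_sub_distrib]

theorem herm_sub_right (z w w' : Fin (n + 1) → ℍq) :
    herm n z (w - w') = herm n z w - herm n z w' := by
  simp [herm_eq_sum, sub_mul, Finset.sum_sub_distrib]

theorem herm_mul_left (z w : Fin (n + 1) → ℍq) (c : ℍq) :
    herm n (fun j => z j * c) w = herm n z w * c := by
  simp [herm_eq_sum, Finset.sum_mul, mul_assoc]

theorem herm_mul_right (z w : Fin (n + 1) → ℍq) (c : ℍq) :
    herm n z (fun j => w j * c) = star c * herm n z w := by
  simp [herm_eq_sum, Finset.mul_sum, mul_assoc]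

theorem herm_self_eq_coe_re (z : Fin (n + 1) → ℍq) :
    herm n z z = ((herm n z z).re : ℍq) :=
  Quaternion.star_eq_self.mp (star_herm z z)

theorem herm_eq_dotProduct (z w : Fin (n + 1) → ℍq) :
    herm n z w = star w ⬝ᵥ (qHmat n *ᵥ z) := by
  simp [herm, dotProduct, mulVec, Finset.mul_sum, mul_assoc]

theorem herm_self_of_apply_zero_eq_last {u : Fin (n + 1) → ℍq} (hu : u 0 = u (Fin.last n)) :
    (herm n u u).re = ∑ k, Quaternion.normSq (u k) := by
  have hperm : ∀ k, u (Equiv.swap 0 (Fin.last n) k) = u k := by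
    intro k
    rw [Equiv.swap_apply_def]
    split_ifs with h1 h2
    · rw [h1, hu]
    · rw [h2, hu]
    · rfl
  have h : herm n u u = ((∑ k, Quaternion.normSq (u k) : ℝ) : ℍq) := by
    rw [herm_eq_sum]
    simp only [hperm, Quaternion.star_mul_self]
    exact (map_sum (algebraMap ℝ ℍq) _ _).symm
  rw [h, Quaternion.re_coe]

/-- The form is positive definite on the orthogonal complement of a negative vector. -/
theorem eq_zero_of_herm_eq_zero {v w : Fin (n + 1) → ℍq} (hw : (herm n w w).re < 0)
    (hvw : herm n v w = 0) (hv : (herm n v v).re ≤ 0) : v = 0 := by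
  have hw0 : w 0 - w (Fin.last n) ≠ 0 := by
    intro h
    rw [herm_self_of_apply_zero_eq_last (sub_eq_zero.mp h)] at hw
    exact absurd hw (not_lt.mpr (Finset.sum_nonneg fun _ _ => Quaternion.normSq_nonneg))
  set b : ℍq := -((w 0 - w (Fin.last n))⁻¹ * (v 0 - v (Fin.last n))) with hb
  set u : Fin (n + 1) → ℍq := v + fun j => w j * b with hu
  have hu0 : u 0 = u (Fin.last n) := by
    have h : (w 0 - w (Fin.last n)) * b = -(v 0 - v (Fin.last n)) := by
      rw [hb, mul_neg, mul_inv_cancel_left₀ hw0]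
    rw [← sub_eq_zero]
    calc u 0 - u (Fin.last n)
        = (v 0 - v (Fin.last n)) + (w 0 - w (Fin.last n)) * b := by
          simp only [hu, Pi.add_apply]; noncomm_ring
      _ = 0 := by rw [h, add_neg_cancel]
  have hwv : herm n w v = 0 := by rw [← star_herm, hvw, star_zero]
  have huu : (herm n u u).re = (herm n v v).re + Quaternion.normSq b * (herm n w w).re := by
    have h : herm n u u = herm n v v + star b * herm n w w * b := by
      simp [hu, herm_add_left, herm_add_right, herm_mul_left, herm_mul_right, hvw, hwv,
        mul_assoc]
    rw [h, herm_self_eq_coe_re w, mul_assoc, Quaternion.coe_commutes, ← mul_assoc,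
      Quaternion.star_mul_self]
    simp
  rw [herm_self_of_apply_zero_eq_last hu0] at huu
  have hnn : 0 ≤ ∑ k, Quaternion.normSq (u k) :=
    Finset.sum_nonneg fun _ _ => Quaternion.normSq_nonneg
  have hbnn : 0 ≤ Quaternion.normSq b := Quaternion.normSq_nonneg
  have hb0 : b = 0 := by
    rw [← Quaternion.normSq_eq_zero]
    nlinarith
  have hsum : ∑ k, Quaternion.normSq (u k) = 0 := by
    refine le_antisymm ?_ hnn
    rw [huu, hb0]
    simpa using hv
  have huv : u = v := by
    funext j
    simp [hu, hb0]
  rw [← huv]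
  funext k
  exact Quaternion.normSq_eq_zero.mp
    ((Finset.sum_eq_zero_iff_of_nonneg fun _ _ => Quaternion.normSq_nonneg).mp hsum k
      (Finset.mem_univ k))

theorem conjTranspose_mul_qHmat_mul {C : Matrix (Fin (n + 1)) (Fin (n + 1)) ℍq}
    (hC : ∀ z w, herm n (C *ᵥ z) (C *ᵥ w) = herm n z w) : Cᴴ * qHmat n * C = qHmat n := by
  ext i j : 1
  have h := hC (Pi.single j 1) (Pi.single i 1)
  simp only [herm_eq_dotProduct, star_mulVec, ← dotProduct_mulVec, mulVec_mulVec] at h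
  simpa [← Pi.single_star, mulVec_single_one, ← Matrix.mul_assoc] using h

/-- If `c = ⟨x, x - y⟩` is nonzero and `⟨x, x⟩ = ⟨y, y⟩`, the quaternionic reflection
`z ↦ z - (x - y) c⁻¹ ⟨z, x - y⟩` is an isometry carrying `x` to `y`. -/
theorem exists_reflection {x y : Fin (n + 1) → ℍq} (hxy : herm n x x = herm n y y)
    (hc : herm n x (x - y) ≠ 0) :
    ∃ D : Matrix (Fin (n + 1)) (Fin (n + 1)) ℍq,
      (∀ z w, herm n (D *ᵥ z) (D *ᵥ w) = herm n z w) ∧ D *ᵥ x = y ∧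
        ∀ z, herm n z (x - y) = 0 → D *ᵥ z = z := by
  set v := x - y with hv
  set c := herm n x v with hcdef
  set a : ℍq := -c⁻¹ with ha
  have hD : ∀ z, (1 + vecMulVec (fun i => v i * a) (star v ᵥ* qHmat n)) *ᵥ z =
      z + fun j => v j * (a * herm n z v) := by
    intro z
    rw [add_mulVec, one_mulVec]
    congr 1
    funext j
    simp only [mulVec, vecMulVec_apply, herm_eq_dotProduct, dotProduct_mulVec]
    simp [dotProduct, Finset.mul_sum, mul_assoc]
  have hvv : herm n v v = c + star c := by
    have h : star c = herm n v x := star_herm x v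
    rw [h, hcdef, hv]
    simp only [herm_sub_left, herm_sub_right, hxy]
    noncomm_ring
  have hkey : a + star a + star a * herm n v v * a = 0 := by
    have hc' : star c ≠ 0 := star_ne_zero.mpr hc
    have h1 : star c⁻¹ * (c + star c) * c⁻¹ = c⁻¹ + star c⁻¹ := by
      rw [star_inv₀, mul_add, add_mul, inv_mul_cancel₀ hc', one_mul, mul_assoc,
        mul_inv_cancel₀ hc, mul_one, add_comm]
    rw [hvv, ha, star_neg, neg_mul, neg_mul, mul_neg, neg_neg, h1]
    abel
  refine ⟨1 + vecMulVec (fun i => v i * a) (star v ᵥ* qHmat n), fun z w => ?_, ?_,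
    fun z hz => ?_⟩
  · rw [hD, hD]
    simp only [herm_add_left, herm_add_right, herm_mul_left, herm_mul_right]
    rw [← star_herm w v, star_mul]
    have h : star (herm n w v) * (a + star a + star a * herm n v v * a) * herm n z v = 0 := by
      rw [hkey, mul_zero, zero_mul]
    refine Eq.trans ?_ (add_zero _)
    rw [← h]
    noncomm_ring
  · rw [hD, ← hcdef, ha, neg_mul, inv_mul_cancel₀ hc]
    funext j
    simp [hv]
  · rw [hD, hz]
    funext j
    simp

/-- Witt extension for families of negative vectors: equal Gram matrices imply congruence. -/
theorem exists_isometry_of_herm_eq {m : ℕ} {p q : Fin m → Fin (n + 1) → ℍq}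
    (hneg : ∀ k, (herm n (p k) (p k)).re < 0)
    (hpq : ∀ j k, herm n (p j) (p k) = herm n (q j) (q k)) :
    ∃ C : Matrix (Fin (n + 1)) (Fin (n + 1)) ℍq,
      Cᴴ * qHmat n * C = qHmat n ∧ ∀ k, C *ᵥ p k = q k := by
  have main : ∀ i : ℕ, ∃ C : Matrix (Fin (n + 1)) (Fin (n + 1)) ℍq,
      (∀ z w, herm n (C *ᵥ z) (C *ᵥ w) = herm n z w) ∧
        ∀ k : Fin m, (k : ℕ) < i → C *ᵥ p k = q k := by
    intro i
    induction i with
    | zero => exact ⟨1, by simp, by simp⟩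
    | succ i ih =>
      obtain ⟨C, hC, hCp⟩ := ih
      by_cases him : i < m
      swap
      · exact ⟨C, hC, fun k _ => hCp k (by omega)⟩
      have hxy : herm n (C *ᵥ p ⟨i, him⟩) (C *ᵥ p ⟨i, him⟩) =
          herm n (q ⟨i, him⟩) (q ⟨i, him⟩) := by rw [hC, hpq]
      by_cases hc : herm n (C *ᵥ p ⟨i, him⟩) (C *ᵥ p ⟨i, him⟩ - q ⟨i, him⟩) = 0
      · have hc' : herm n (C *ᵥ p ⟨i, him⟩ - q ⟨i, him⟩) (C *ᵥ p ⟨i, him⟩) = 0 := by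
          rw [← star_herm, hc, star_zero]
        have hv : C *ᵥ p ⟨i, him⟩ - q ⟨i, him⟩ = 0 := by
          refine eq_zero_of_herm_eq_zero (w := C *ᵥ p ⟨i, him⟩) ?_ hc' ?_
          · rw [hC]
            exact hneg _
          · have h0 : herm n (C *ᵥ p ⟨i, him⟩ - q ⟨i, him⟩)
                (C *ᵥ p ⟨i, him⟩ - q ⟨i, him⟩) = 0 := by
              rw [herm_sub_left, hc, zero_sub, neg_eq_zero]
              rw [herm_sub_right] at hc ⊢
              rw [herm_sub_left] at hc'
              rw [← hxy, ← sub_eq_zero.mp hc', sub_self]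
            rw [h0, Quaternion.re_zero]
        refine ⟨C, hC, fun k hk => ?_⟩
        rcases Nat.lt_succ_iff_lt_or_eq.mp hk with hk | hk
        · exact hCp k hk
        · obtain rfl : k = ⟨i, him⟩ := Fin.ext hk
          exact sub_eq_zero.mp hv
      · obtain ⟨D, hD, hDx, hDz⟩ := exists_reflection hxy hc
        refine ⟨D * C, fun z w => ?_, fun k hk => ?_⟩
        · rw [← mulVec_mulVec, ← mulVec_mulVec, hD, hC]
        · rw [← mulVec_mulVec]
          rcases Nat.lt_succ_iff_lt_or_eq.mp hk with hk | hk
          · rw [hCp k hk]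
            apply hDz
            rw [herm_sub_right, ← hpq, ← hCp k hk, hC, sub_self]
          · obtain rfl : k = ⟨i, him⟩ := Fin.ext hk
            exact hDx
  obtain ⟨C, hC, hCp⟩ := main m
  exact ⟨C, conjTranspose_mul_qHmat_mul hC, fun k => hCp k k.isLt⟩

end HermitianForm

section Quaternions

theorem norm_im_smul_rotInv (g : ℍq) : ‖g.im‖ • rotInv g = g.im := by
  unfold rotInv
  split_ifs with h
  · simp [h]
  · rw [smul_smul, mul_inv_cancel₀ (norm_ne_zero_iff.mpr h), one_smul]

theorem norm_sq_eq_re_sq_add_norm_im_sq (g : ℍq) : ‖g‖ ^ 2 = g.re ^ 2 + ‖g.im‖ ^ 2 := by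
  rw [pow_two, pow_two ‖g.im‖, ← Quaternion.normSq_eq_norm_mul_self,
    ← Quaternion.normSq_eq_norm_mul_self, Quaternion.normSq_def', Quaternion.normSq_def']
  simp
  ring

theorem abs_re_le_norm (g : ℍq) : |g.re| ≤ ‖g‖ := by
  refine abs_le_of_sq_le_sq ?_ (norm_nonneg g)
  nlinarith [norm_sq_eq_re_sq_add_norm_im_sq g, sq_nonneg ‖g.im‖]

theorem star_mul_self_of_norm_eq_one {μ : ℍq} (hμ : ‖μ‖ = 1) : star μ * μ = 1 := by
  rw [Quaternion.star_mul_self, Quaternion.normSq_eq_norm_mul_self, hμ]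
  simp

theorem star_mul_coe_mul_of_norm_eq_one {μ : ℍq} (hμ : ‖μ‖ = 1) (r : ℝ) :
    star μ * (r : ℍq) * μ = (r : ℍq) := by
  rw [mul_assoc, Quaternion.coe_commutes, ← mul_assoc, star_mul_self_of_norm_eq_one hμ, one_mul]

theorem eq_conj_of_rotInv_eq {g h μ : ℍq} (hμ : ‖μ‖ = 1) (hnorm : ‖g‖ = ‖h‖)
    (hre : g.re = h.re) (hrot : rotInv g = star μ * rotInv h * μ) : g = star μ * h * μ := by
  have him : ‖g.im‖ = ‖h.im‖ := by
    rw [← sq_eq_sq₀ (norm_nonneg _) (norm_nonneg _)]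
    have hg := norm_sq_eq_re_sq_add_norm_im_sq g
    have hh := norm_sq_eq_re_sq_add_norm_im_sq h
    rw [hnorm, hre] at hg
    linarith
  have him' : g.im = star μ * h.im * μ := by
    rw [← norm_im_smul_rotInv g, ← norm_im_smul_rotInv h, hrot, him, mul_smul_comm,
      smul_mul_assoc]
  rw [← Quaternion.re_add_im g, ← Quaternion.re_add_im h, mul_add, add_mul,
    star_mul_coe_mul_of_norm_eq_one hμ, ← him', hre]

end Quaternions

section Invariants

variable {n : ℕ}

theorem norm_herm_eq_of_dInv_eq {z w z' w' : Fin (n + 1) → ℍq}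
    (hz : herm n z z = -1) (hw : herm n w w = -1)
    (hz' : herm n z' z' = -1) (hw' : herm n w' w' = -1)
    (h : dInv n z w = dInv n z' w') : ‖herm n z w‖ = ‖herm n z' w'‖ := by
  simp only [dInv, hz, hw, hz', hw', mul_neg, mul_one, neg_neg, div_one] at h
  rw [← star_herm z w, ← star_herm z' w'] at h
  have h' := congrArg norm h
  rw [norm_mul, norm_mul, _root_.norm_star, _root_.norm_star] at h'
  exact (mul_self_inj (norm_nonneg _) (norm_nonneg _)).mp h'

theorem angInv_of_herm_pos {z₁ z₂ z₃ : Fin (n + 1) → ℍq} {r s : ℝ} (hr : 0 < r) (hs : 0 < s)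
    (h₂ : herm n z₁ z₂ = (r : ℍq)) (h₃ : herm n z₁ z₃ = (s : ℍq)) :
    angInv n z₁ z₂ z₃ = Real.arccos (-((herm n z₂ z₃).re / ‖herm n z₂ z₃‖)) := by
  have h₃' : herm n z₃ z₁ = (s : ℍq) := by rw [← star_herm, h₃, Quaternion.star_coe]
  have hT : herm n z₁ z₂ * herm n z₂ z₃ * herm n z₃ z₁ = (r * s) • herm n z₂ z₃ := by
    rw [h₂, h₃', mul_assoc, ← Quaternion.coe_commutes, ← mul_assoc, ← Quaternion.coe_mul,
      Quaternion.coe_mul_eq_smul]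
  have hrs : 0 < r * s := mul_pos hr hs
  unfold angInv
  rw [hT, norm_smul, Real.norm_of_nonneg hrs.le]
  congr 1
  rw [Quaternion.re_neg, Quaternion.re_smul, smul_eq_mul, neg_div,
    mul_div_mul_left _ _ hrs.ne']

theorem re_eq_of_arccos_eq {g h : ℍq} (hnorm : ‖g‖ = ‖h‖)
    (harc : Real.arccos (-(g.re / ‖g‖)) = Real.arccos (-(h.re / ‖h‖))) : g.re = h.re := by
  by_cases h0 : ‖h‖ = 0
  · rw [norm_eq_zero.mp h0, norm_eq_zero.mp (hnorm.trans h0)]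
  have hmem : ∀ x : ℍq, -(x.re / ‖x‖) ∈ Set.Icc (-1 : ℝ) 1 := fun x => by
    rw [Set.mem_Icc, ← abs_le, abs_neg, abs_div, abs_norm]
    exact div_le_one_of_le₀ (abs_re_le_norm x) (norm_nonneg x)
  have heq := neg_injective (Real.arccos_injOn (hmem g) (hmem h) harc)
  rw [hnorm] at heq
  exact (div_left_inj' h0).mp heq

end Invariants

/-- **Interior case (all points negative).** Two normalized `m`-tuples of negative
vectors (`m ≥ 4`, `⟨p_k,p_k⟩ = −1`, `⟨p₁,p_j⟩` positive real) with equal angular and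
distance invariants and whose rotation invariants agree up to conjugation by one unit
quaternion, are PSp(n,1)-congruent. -/
theorem moduli_congruence_negative (n m : ℕ) (hm : 4 ≤ m)
    (p q : Fin m → Fin (n+1) → ℍq)
    (hpd : ∀ k l : Fin m, k ≠ l → ∀ c : ℍq, p k ≠ fun j => p l j * c)
    (hqd : ∀ k l : Fin m, k ≠ l → ∀ c : ℍq, q k ≠ fun j => q l j * c)
    (hpn : ∀ k, herm n (p k) (p k) = -1) (hqn : ∀ k, herm n (q k) (q k) = -1)
    (hppos : ∀ j : Fin m, 1 ≤ (j : ℕ) →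
      ∃ r : ℝ, 0 < r ∧ herm n (p ⟨0, by omega⟩) (p j) = (r : ℍq))
    (hqpos : ∀ j : Fin m, 1 ≤ (j : ℕ) →
      ∃ r : ℝ, 0 < r ∧ herm n (q ⟨0, by omega⟩) (q j) = (r : ℍq))
    (hAd : ∀ k j : Fin m, (k : ℕ) < (j : ℕ) →
      angInv n (p ⟨0, by omega⟩) (p k) (p j) = angInv n (q ⟨0, by omega⟩) (q k) (q j) ∧
      dInv n (p k) (p j) = dInv n (q k) (q j))
    (hμ : ∃ μ : ℍq, ‖μ‖ = 1 ∧
      ∀ k j : Fin m, 1 ≤ (k : ℕ) → (k : ℕ) < (j : ℕ) →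
        rotInv (herm n (p j) (p k)) = star μ * rotInv (herm n (q j) (q k)) * μ) :
    PSpCongruent n m p q := by
  obtain ⟨μ, hμ1, hrot⟩ := hμ
  have hnorm : ∀ k j : Fin m, (k : ℕ) < j → ‖herm n (p k) (p j)‖ = ‖herm n (q k) (q j)‖ :=
    fun k j hkj => norm_herm_eq_of_dInv_eq (hpn k) (hpn j) (hqn k) (hqn j) (hAd k j hkj).2
  have hlt : ∀ k j : Fin m, (k : ℕ) < j →
      herm n (p j) (p k) = star μ * herm n (q j) (q k) * μ := by
    intro k j hkj
    have hnkj := hnorm k j hkj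
    obtain ⟨s, hs, hps⟩ := hppos j (by omega)
    obtain ⟨s', hs', hqs⟩ := hqpos j (by omega)
    by_cases hk : (k : ℕ) = 0
    · have hk0 : k = ⟨0, by omega⟩ := Fin.ext hk
      rw [hk0] at hnkj ⊢
      have hss : s = s' := by
        rw [hps, hqs, Quaternion.norm_coe, Quaternion.norm_coe, Real.norm_of_nonneg hs.le,
          Real.norm_of_nonneg hs'.le] at hnkj
        exact hnkj
      rw [← star_herm, hps, ← star_herm _ (q j), hqs, Quaternion.star_coe, Quaternion.star_coe,
        star_mul_coe_mul_of_norm_eq_one hμ1, hss]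
    · obtain ⟨r, hr, hpr⟩ := hppos k (by omega)
      obtain ⟨r', hr', hqr⟩ := hqpos k (by omega)
      have hang := (hAd k j hkj).1
      rw [angInv_of_herm_pos hr hs hpr hps, angInv_of_herm_pos hr' hs' hqr hqs] at hang
      have hre := re_eq_of_arccos_eq hnkj hang
      refine eq_conj_of_rotInv_eq hμ1 ?_ ?_ (hrot k j (by omega) hkj)
      · rw [← star_herm, ← star_herm (q k), _root_.norm_star, _root_.norm_star, hnkj]
      · rw [← star_herm, ← star_herm (q k), Quaternion.re_star, Quaternion.re_star, hre]
  have hgram : ∀ j k, herm n (p j) (p k) =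
      herm n (fun i => q j i * μ) (fun i => q k i * μ) := by
    intro j k
    rw [herm_mul_left, herm_mul_right]
    rcases lt_trichotomy (k : ℕ) j with h | h | h
    · exact hlt k j h
    · obtain rfl : k = j := Fin.ext h
      rw [hpn, hqn, mul_neg, mul_one, neg_mul, star_mul_self_of_norm_eq_one hμ1]
    · rw [← star_herm, hlt j k h, ← star_herm (q k)]
      simp [mul_assoc]
  obtain ⟨C, hC, hCp⟩ := exists_isometry_of_herm_eq (p := p) (q := fun k i => q k i * μ)
    (fun k => by rw [hpn]; simp) hgram
  refine ⟨C, hC, fun _ => μ, fun _ hμ0 => ?_, hCp⟩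
  rw [show μ = 0 from hμ0, norm_zero] at hμ1
  exact zero_ne_one hμ1
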